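/- arXiv:1707.09357 — 2 statements merged into one kernel-verified Lean document; each statement's English description precedes it below -/
import Mathlib

section
/- Let f be a homeomorphism of a compact metric space (X,d) and let n be a positive integer. If f is n-expansive, topologically transitive, and has the shadowing property, then f has the two-sided limit shadowing property with a gap; that is, there exists N ∈ ℕ such that every two-sided limit pseudo-orbit of f is two-sided limit shadowed with some gap K ∈ ℤ satisfying |K| ≤ N. -/
open Metric Filter Set

variable {X : Type*} [MetricSpace X]

/-- The iterate of a homeomorphism by an integer power. -/
def hIter (f : X ≃ₜ X) (k : ℤ) (x : X) : X := (f.toEquiv ^ k) x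

/-- The local stable set of `x` of size `c`:
points whose forward iterates stay `c`-close to those of `x`. -/
def localStable (f : X ≃ₜ X) (c : ℝ) (x : X) : Set X :=
  {y | ∀ k : ℕ, dist ((⇑f)^[k] y) ((⇑f)^[k] x) ≤ c}

/-- The local unstable set of `x` of size `c`:
points whose backward iterates stay `c`-close to those of `x`. -/
def localUnstable (f : X ≃ₜ X) (c : ℝ) (x : X) : Set X :=
  {y | ∀ k : ℕ, dist ((⇑f.symm)^[k] y) ((⇑f.symm)^[k] x) ≤ c}

/-- The stable set of `x`. -/
def stableSet (f : X ≃ₜ X) (x : X) : Set X :=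
  {y | Tendsto (fun k : ℕ => dist ((⇑f)^[k] y) ((⇑f)^[k] x)) atTop (nhds 0)}

/-- The unstable set of `x`. -/
def unstableSet (f : X ≃ₜ X) (x : X) : Set X :=
  {y | Tendsto (fun k : ℕ => dist ((⇑f.symm)^[k] y) ((⇑f.symm)^[k] x)) atTop (nhds 0)}

/-- `f` is positively `n`-expansive: for some `c > 0` every local stable set of
size `c` contains at most `n` points. -/
def PosNExpansive (f : X ≃ₜ X) (n : ℕ) : Prop :=
  ∃ c > 0, ∀ x : X, ∀ S : Finset X, ↑S ⊆ localStable f c x → S.card ≤ n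

/-- `f` is `n`-expansive: for some `c > 0` every dynamical ball of size `c`
contains at most `n` points. -/
def NExpansive (f : X ≃ₜ X) (n : ℕ) : Prop :=
  ∃ c > 0, ∀ x : X, ∀ S : Finset X,
    ↑S ⊆ localStable f c x ∩ localUnstable f c x → S.card ≤ n

/-- `f` is expansive. -/
def Expansive (f : X ≃ₜ X) : Prop :=
  ∃ c > 0, ∀ x y : X, (∀ k : ℤ, dist (hIter f k x) (hIter f k y) ≤ c) → x = y

/-- `(x_k)_{k ∈ ℤ}` is a `δ`-pseudo-orbit. -/
def IsPseudoOrbit (f : X ≃ₜ X) (δ : ℝ) (x : ℤ → X) : Prop :=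
  ∀ k : ℤ, dist (f (x k)) (x (k + 1)) < δ

/-- `(x_k)_{k ∈ ℤ}` is a two-sided limit pseudo-orbit:
`d(f(x_k), x_{k+1}) → 0` as `|k| → ∞`. -/
def IsTwoSidedLimitPseudoOrbit (f : X ≃ₜ X) (x : ℤ → X) : Prop :=
  Tendsto (fun k : ℤ => dist (f (x k)) (x (k + 1))) cofinite (nhds 0)

/-- `z` `ε`-shadows the sequence `(x_k)_{k ∈ ℤ}`. -/
def Shadows (f : X ≃ₜ X) (ε : ℝ) (z : X) (x : ℤ → X) : Prop :=
  ∀ k : ℤ, dist (hIter f k z) (x k) < ε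

/-- `z` two-sided limit shadows `(x_k)_{k ∈ ℤ}`. -/
def TwoSidedLimitShadows (f : X ≃ₜ X) (z : X) (x : ℤ → X) : Prop :=
  Tendsto (fun k : ℤ => dist (hIter f k z) (x k)) cofinite (nhds 0)

/-- The shadowing property. -/
def ShadowingProperty (f : X ≃ₜ X) : Prop :=
  ∀ ε > 0, ∃ δ > 0, ∀ x : ℤ → X, IsPseudoOrbit f δ x → ∃ z : X, Shadows f ε z x

/-- The L-shadowing property. -/
def LShadowingProperty (f : X ≃ₜ X) : Prop :=
  ∀ ε > 0, ∃ δ > 0, ∀ x : ℤ → X, IsPseudoOrbit f δ x →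
    IsTwoSidedLimitPseudoOrbit f x →
    ∃ z : X, Shadows f ε z x ∧ TwoSidedLimitShadows f z x

/-- Topological transitivity. -/
def TopTransitive (f : X ≃ₜ X) : Prop :=
  ∀ U V : Set X, IsOpen U → IsOpen V → U.Nonempty → V.Nonempty →
    ∃ k : ℕ, ((⇑f)^[k] '' U ∩ V).Nonempty

/-- There is a nontrivial finite `ε`-pseudo-orbit from `x` to `y`. -/
def ChainFrom (f : X ≃ₜ X) (ε : ℝ) (x y : X) : Prop :=
  ∃ (l : ℕ) (c : ℕ → X), 0 < l ∧ c 0 = x ∧ c l = y ∧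
    ∀ k < l, dist (f (c k)) (c (k + 1)) < ε

/-- `x` is a chain recurrent point of `f`. -/
def ChainRecurrent (f : X ≃ₜ X) (x : X) : Prop :=
  ∀ ε > 0, ChainFrom f ε x x

/-- The chain recurrent class of `x`. -/
def chainClass (f : X ≃ₜ X) (x : X) : Set X :=
  {y | ∀ ε > 0, ChainFrom f ε x y ∧ ChainFrom f ε y x}

/-- `x` is a periodic point of `f`. -/
def Periodic (f : X ≃ₜ X) (x : X) : Prop :=
  ∃ k : ℕ, 1 ≤ k ∧ (⇑f)^[k] x = x

/-- `x` is a non-wandering point of `f`. -/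
def NonWandering (f : X ≃ₜ X) (x : X) : Prop :=
  ∀ U : Set X, IsOpen U → x ∈ U → ∃ k : ℕ, 0 < k ∧ ((⇑f)^[k] '' U ∩ U).Nonempty

/-- The omega limit set of `x`: accumulation points of the forward orbit. -/
def omegaLimitSet (f : X ≃ₜ X) (x : X) : Set X :=
  {y | ∃ φ : ℕ → ℕ, StrictMono φ ∧ Tendsto (fun n => (⇑f)^[φ n] x) atTop (nhds y)}

/-- `z` two-sided limit shadows `(x_k)` with gap `K`. -/
def TwoSidedLimitShadowsWithGap (f : X ≃ₜ X) (K : ℤ) (z : X) (x : ℤ → X) : Prop :=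
  Tendsto (fun k : ℤ => dist (hIter f k z) (x k)) atBot (nhds 0) ∧
  Tendsto (fun k : ℤ => dist (hIter f (K + k) z) (x k)) atTop (nhds 0)

lemma hIter_zero (f : X ≃ₜ X) (x : X) : hIter f 0 x = x := by simp [hIter]

lemma hIter_add (f : X ≃ₜ X) (a b : ℤ) (x : X) :
    hIter f (a + b) x = hIter f a (hIter f b x) := by
  unfold hIter
  rw [zpow_add]
  rfl

lemma hIter_one (f : X ≃ₜ X) (x : X) : hIter f 1 x = f x := by
  unfold hIter
  rw [zpow_one]
  rfl

lemma hIter_add_one (f : X ≃ₜ X) (k : ℤ) (x : X) : hIter f (k + 1) x = f (hIter f k x) := by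
  rw [add_comm, hIter_add, hIter_one]

lemma hIter_injective (f : X ≃ₜ X) (k : ℤ) : Function.Injective (hIter f k) :=
  (f.toEquiv ^ k).injective

lemma hIter_natCast (f : X ≃ₜ X) (k : ℕ) (x : X) : hIter f k x = f^[k] x := by
  induction k with
  | zero => simp [hIter_zero]
  | succ k ih => rw [Nat.cast_succ, hIter_add_one, ih, Function.iterate_succ_apply']

lemma hIter_symm (f : X ≃ₜ X) (k : ℤ) (x : X) : hIter f.symm k x = hIter f (-k) x := by
  unfold hIter
  rw [zpow_neg, ← inv_zpow]
  rfl

lemma symm_hIter (f : X ≃ₜ X) (k : ℤ) (x : X) : f.symm (hIter f k x) = hIter f (k - 1) x := by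
  rw [f.symm_apply_eq, ← hIter_add_one, sub_add_cancel]

lemma NExpansive.symm {f : X ≃ₜ X} {n : ℕ} (h : NExpansive f n) : NExpansive f.symm n := by
  obtain ⟨c, hc, h⟩ := h
  refine ⟨c, hc, fun x S hS => h x S fun y hy => ⟨(hS hy).2, (hS hy).1⟩⟩

lemma ShadowingProperty.symm [CompactSpace X] {f : X ≃ₜ X} (h : ShadowingProperty f) :
    ShadowingProperty f.symm := by
  intro ε hε
  obtain ⟨δ, hδ, h⟩ := h ε hε
  obtain ⟨η, hη, hf⟩ := Metric.uniformContinuous_iff.1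
    (CompactSpace.uniformContinuous_of_continuous f.continuous) δ hδ
  refine ⟨η, hη, fun x hx => ?_⟩
  obtain ⟨z, hz⟩ := h (fun k => x (-k)) fun k => by
    have := hf (hx (-(k + 1)))
    rw [f.apply_symm_apply, dist_comm] at this
    rwa [show -(k + 1) + 1 = -k by ring] at this
  refine ⟨z, fun k => ?_⟩
  have := hz (-k)
  simpa only [neg_neg, ← hIter_symm] using this

/-- A sequence whose one-step errors tend to `0` in the future. -/
def IsForwardLimitPseudoOrbit (f : X ≃ₜ X) (s : ℤ → X) : Prop :=
  Tendsto (fun k : ℤ => dist (f (s k)) (s (k + 1))) atTop (nhds 0)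

lemma isForwardLimitPseudoOrbit_hIter (f : X ≃ₜ X) (K : ℤ) (z : X) :
    IsForwardLimitPseudoOrbit f (fun k => hIter f (K + k) z) := by
  simp [IsForwardLimitPseudoOrbit, ← add_assoc, hIter_add_one]

lemma IsTwoSidedLimitPseudoOrbit.forward {f : X ≃ₜ X} {x : ℤ → X}
    (hx : IsTwoSidedLimitPseudoOrbit f x) : IsForwardLimitPseudoOrbit f x := by
  unfold IsTwoSidedLimitPseudoOrbit at hx
  rw [Int.cofinite_eq] at hx
  exact hx.mono_left le_sup_right

lemma IsTwoSidedLimitPseudoOrbit.tendsto_atBot {f : X ≃ₜ X} {x : ℤ → X}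
    (hx : IsTwoSidedLimitPseudoOrbit f x) :
    Tendsto (fun k : ℤ => dist (f (x k)) (x (k + 1))) atBot (nhds 0) := by
  unfold IsTwoSidedLimitPseudoOrbit at hx
  rw [Int.cofinite_eq] at hx
  exact hx.mono_left le_sup_left

lemma IsTwoSidedLimitPseudoOrbit.backward [CompactSpace X] {f : X ≃ₜ X} {x : ℤ → X}
    (hx : IsTwoSidedLimitPseudoOrbit f x) :
    IsForwardLimitPseudoOrbit f.symm (fun k => x (-k)) := by
  have h := hx.tendsto_atBot
  have hu := CompactSpace.uniformContinuous_of_continuous f.symm.continuous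
  rw [Metric.uniformContinuous_iff] at hu
  unfold IsForwardLimitPseudoOrbit
  rw [Metric.tendsto_nhds] at h ⊢
  intro ε hε
  obtain ⟨δ, hδ, hu⟩ := hu ε hε
  have h' := (tendsto_neg_atTop_atBot.comp (tendsto_atTop_add_const_right atTop (1 : ℤ)
    tendsto_id)).eventually (h δ hδ)
  filter_upwards [h'] with k hk
  simp only [Function.comp, id, dist_zero_right, Real.norm_eq_abs, abs_dist] at hk ⊢
  have := hu hk
  rw [f.symm_apply_apply, dist_comm] at this
  rwa [show -(k + 1) + 1 = -k by ring] at this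

/-- A limit of time-`k` states of a forward limit pseudo-orbit carries its orbit along. -/
lemma IsForwardLimitPseudoOrbit.tendsto_shift {f : X ≃ₜ X} {s : ℤ → X}
    (hs : IsForwardLimitPseudoOrbit f s) {l : Filter ℤ} (hl : l ≤ atTop) {p : X}
    (hp : Tendsto s l (nhds p)) (j : ℤ) :
    Tendsto (fun k => s (k + j)) l (nhds (hIter f j p)) := by
  have key (j : ℤ) : Tendsto (fun k => dist (f (s (k + j))) (s (k + (j + 1)))) l (nhds 0) := by
    have := (hs.comp (tendsto_atTop_add_const_right atTop j tendsto_id)).mono_left hl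
    simpa [Function.comp_def, add_assoc] using this
  induction j using Int.induction_on with
  | zero => simpa [hIter_zero] using hp
  | succ j ih =>
    rw [hIter_add_one]
    exact ((f.continuous.tendsto _).comp ih).congr_dist (key j)
  | pred j ih =>
    have h := key (-j - 1)
    simp only [sub_add_cancel, dist_comm] at h
    have h2 := (f.symm.continuous.tendsto _).comp (ih.congr_dist h)
    rw [symm_hIter] at h2
    simpa [Function.comp_def] using h2

lemma NExpansive.exists_not_injective {f : X ≃ₜ X} {n : ℕ} (h : NExpansive f n) :
    ∃ c > 0, ∀ p : Fin (n + 1) → X,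
      (∀ i j, ∀ k : ℤ, dist (hIter f k (p i)) (hIter f k (p j)) ≤ c) → ¬ Function.Injective p := by
  obtain ⟨c, hc, h⟩ := h
  refine ⟨c, hc, fun p hp hinj => ?_⟩
  have := h (p 0) (Finset.univ.map ⟨p, hinj⟩) fun y hy => by
    simp only [Finset.coe_map, Function.Embedding.coeFn_mk, Finset.coe_univ, image_univ,
      mem_range] at hy
    obtain ⟨i, rfl⟩ := hy
    refine ⟨fun k => ?_, fun k => ?_⟩
    · rw [← hIter_natCast, ← hIter_natCast]
      exact hp i 0 k
    · rw [← hIter_natCast, ← hIter_natCast, hIter_symm, hIter_symm]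
      exact hp i 0 _
  simp at this

/-- `c` is an `n`-expansivity constant, phrased for families of `n + 1` points. -/
def IsExpansivityConst (f : X ≃ₜ X) (n : ℕ) (c : ℝ) : Prop :=
  ∀ p : Fin (n + 1) → X,
    (∀ i j, ∀ k : ℤ, dist (hIter f k (p i)) (hIter f k (p j)) ≤ c) → ¬ Function.Injective p

/-- Among `n + 1` mutually close forward limit pseudo-orbits, two are not uniformly separated. -/
lemma IsExpansivityConst.not_separated [CompactSpace X] {f : X ≃ₜ X} {n : ℕ} {c : ℝ}
    (h : IsExpansivityConst f n c) {s : Fin (n + 1) → ℤ → X}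
    (hs : ∀ i, IsForwardLimitPseudoOrbit f (s i))
    (hclose : ∀ i j, ∀ᶠ k in atTop, dist (s i k) (s j k) ≤ c) {ρ : ℝ} (hρ : 0 < ρ)
    (hsep : ∀ i j, i ≠ j → ∀ᶠ k in atTop, ρ ≤ dist (s i k) (s j k)) : False := by
  let U : Ultrafilter ℤ := Ultrafilter.of atTop
  have hU : (U : Filter ℤ) ≤ atTop := Ultrafilter.of_le _
  have hlim (i) : ∃ p, Tendsto (s i) U (nhds p) := by
    obtain ⟨p, -, hp⟩ := isCompact_univ.ultrafilter_le_nhds (U.map (s i)) (by simp)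
    exact ⟨p, hp⟩
  choose p hp using hlim
  refine h p (fun i j k => ?_) fun i j hij => ?_
  · have hk := ((tendsto_atTop_add_const_right atTop k tendsto_id).mono_left hU).eventually
      (hclose i j)
    exact le_of_tendsto (((hs i).tendsto_shift hU (hp i) k).dist
      ((hs j).tendsto_shift hU (hp j) k)) hk
  · by_contra hne
    have := ge_of_tendsto ((hp i).dist (hp j)) ((hsep i j hne).filter_mono hU)
    rw [hij, dist_self] at this
    linarith

/-- Excursion times of two sequences that are recurrently close and recurrently far apart. -/
lemma exists_excursions {C D : ℤ → Prop} (hC : ∃ᶠ k in atTop, C k) (hD : ∃ᶠ k in atTop, D k)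
    (m : ℤ) : ∃ a : ℕ → ℤ, m < a 0 ∧ StrictMono a ∧ (∀ i, C (a i)) ∧
      ∀ i, ∃ b, a i ≤ b ∧ b < a (i + 1) ∧ D b := by
  rw [frequently_atTop] at hC hD
  have step (m : ℤ) : ∃ m', m < m' ∧ C m' ∧ ∃ b, m ≤ b ∧ b < m' ∧ D b := by
    obtain ⟨b, hb, hDb⟩ := hD m
    obtain ⟨m', hm', hCm'⟩ := hC (b + 1)
    exact ⟨m', by omega, hCm', b, hb, by omega, hDb⟩
  choose g hg hgC hgD using step
  refine ⟨fun i => Nat.rec (g m) (fun _ => g) i, hg m, strictMono_nat_of_lt_succ fun i => hg _,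
    fun i => ?_, fun i => hgD _⟩
  cases i <;> exact hgC _

/-- Two close forward limit pseudo-orbits that approach each other recurrently are asymptotic. -/
lemma IsExpansivityConst.tendsto_of_frequently {f : X ≃ₜ X} {n : ℕ} {c : ℝ}
    (hc : 0 < c) (h : IsExpansivityConst f n c) (hshad : ShadowingProperty f) {s t : ℤ → X}
    (hs : IsForwardLimitPseudoOrbit f s) (ht : IsForwardLimitPseudoOrbit f t)
    (hclose : ∀ᶠ k in atTop, dist (t k) (s k) ≤ c / 2)
    (hfreq : ∀ η > 0, ∃ᶠ k in atTop, dist (t k) (s k) < η) :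
    Tendsto (fun k => dist (t k) (s k)) atTop (nhds 0) := by
  by_contra hnot
  obtain ⟨ρ, hρ, hfar⟩ : ∃ ρ > 0, ∃ᶠ k in atTop, ρ ≤ dist (t k) (s k) := by
    rw [Metric.tendsto_nhds] at hnot
    push Not at hnot
    simpa using hnot
  obtain ⟨δ, hδ, hshad⟩ := hshad (min (c / 4) (ρ / 4)) (by positivity)
  have es := hs.eventually (gt_mem_nhds (half_pos hδ))
  have et := ht.eventually (gt_mem_nhds (half_pos hδ))
  obtain ⟨m, hm⟩ := eventually_atTop.1 (es.and (et.and hclose))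
  obtain ⟨a, ha0, hamono, haC, haD⟩ := exists_excursions (hfreq _ (half_pos hδ)) hfar m
  choose b hab hba hb using haD
  have ham (i) : m < a i := ha0.trans_le (hamono.monotone (Nat.zero_le i))
  have hlt (i) : a i < a (i + 1) := hamono (Nat.lt_succ_self i)
  let u (i : ℕ) (k : ℤ) : X :=
    if k < m then hIter f (k - m) (s m) else if a i ≤ k ∧ k < a (i + 1) then t k else s k
  have hu (i) : IsPseudoOrbit f δ (u i) := by
    intro k
    have hi := ham i
    have hi' := hlt i
    rcases lt_trichotomy (k + 1) m with hk | hk | hk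
    · simp only [u, if_pos hk, if_pos (show k < m by omega)]
      rw [show k + 1 - m = k - m + 1 by ring, hIter_add_one, dist_self]
      exact hδ
    · have h1 : k < m := by omega
      have h2 : ¬ (a i ≤ m) := by omega
      simp only [u, hk, h1, h2, if_true, lt_irrefl, if_false, false_and]
      rw [← hIter_add_one, show k - m + 1 = 0 by omega, hIter_zero, dist_self]
      exact hδ
    · obtain ⟨hms, hmt, -⟩ := hm k (by omega)
      have h1 : ¬ k < m := by omega
      have h2 : ¬ k + 1 < m := by omega
      simp only [u, h1, h2, if_false]
      split_ifs with h3 h4 h4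
      · linarith
      · have : k + 1 = a (i + 1) := by omega
        have hC := haC (i + 1)
        rw [← this] at hC
        have := dist_triangle (f (t k)) (t (k + 1)) (s (k + 1))
        linarith
      · have : k + 1 = a i := by omega
        have hC := haC i
        rw [← this, dist_comm] at hC
        have := dist_triangle (f (s k)) (s (k + 1)) (t (k + 1))
        linarith
      · linarith
  have hudist (i j k) : dist (u i k) (u j k) ≤ c / 2 := by
    by_cases h1 : k < m
    · simp only [u, h1, if_true, dist_self]; positivity
    · have := (hm k (by omega)).2.2
      have h' := this
      rw [dist_comm] at h'
      simp only [u, h1, if_false]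
      split_ifs <;> first | assumption | (rw [dist_self]; positivity)
  choose z hz using fun i => hshad (u i) (hu i)
  have hne {i j : ℕ} (hij : i ≠ j) : z i ≠ z j := by
    intro heq
    have e1 : u i (b i) = t (b i) := by
      have := ham i
      have h0 := hab i
      have h1 : ¬ b i < m := by omega
      simp only [u, h1, if_false, hab i, hba i, and_self, if_true]
    have e2 : u j (b i) = s (b i) := by
      have := ham i
      have h0 := hab i
      have h0' := hba i
      have h1 : ¬ b i < m := by omega
      have h2 : ¬ (a j ≤ b i ∧ b i < a (j + 1)) := by
        rcases hij.lt_or_gt with hlt | hlt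
        · have := hamono.monotone (show i + 1 ≤ j from hlt)
          omega
        · have := hamono.monotone (show j + 1 ≤ i from hlt)
          omega
      simp only [u, h1, h2, if_false]
    have h1 := hz i (b i)
    have h2 := hz j (b i)
    rw [e1] at h1
    rw [← heq, e2] at h2
    have h3 := dist_triangle_left (t (b i)) (s (b i)) (hIter f (b i) (z i))
    have h4 := min_le_right (c / 4) (ρ / 4)
    linarith [hb i]
  refine h (fun i => z i) (fun i j k => ?_) fun i j hij => ?_
  · have h1 := hz i k
    have h2 := hz j k
    rw [dist_comm] at h2
    have h3 := dist_triangle4 (hIter f k (z i)) (u i k) (u j k) (hIter f k (z j))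
    have h4 := min_le_left (c / 4) (ρ / 4)
    linarith [hudist i j k]
  · by_contra hne'
    exact hne (fun h => hne' (Fin.ext h)) hij

/-- Forward limit pseudo-orbits eventually close enough to a given one are asymptotic to it. -/
lemma NExpansive.exists_asymptotic_radius [CompactSpace X] {f : X ≃ₜ X} {n : ℕ}
    (hexp : NExpansive f n) (hshad : ShadowingProperty f) {s : ℤ → X}
    (hs : IsForwardLimitPseudoOrbit f s) :
    ∃ r > 0, ∀ t, IsForwardLimitPseudoOrbit f t → (∀ᶠ k in atTop, dist (t k) (s k) ≤ r) →
      Tendsto (fun k => dist (t k) (s k)) atTop (nhds 0) := by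
  obtain ⟨c, hc, hexp : IsExpansivityConst f n c⟩ := hexp.exists_not_injective
  by_contra! hcon
  have sep (r : ℝ) (hr : 0 < r) : ∃ t, IsForwardLimitPseudoOrbit f t ∧
      (∀ᶠ k in atTop, dist (t k) (s k) ≤ min (c / 2) r) ∧
      ∃ ρ > 0, ∀ᶠ k in atTop, ρ ≤ dist (t k) (s k) := by
    obtain ⟨t, ht, htr, hnot⟩ := hcon (min (c / 2) r) (by positivity)
    refine ⟨t, ht, htr, ?_⟩
    by_contra! hfreq
    refine hnot (hexp.tendsto_of_frequently hc hshad hs ht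
      (htr.mono fun k hk => hk.trans (min_le_left _ _)) fun η hη => ?_)
    simpa using hfreq η hη
  have family (m : ℕ) : ∃ T : Fin m → ℤ → X, ∃ ρ > 0,
      (∀ i, IsForwardLimitPseudoOrbit f (T i)) ∧
      (∀ i, ∀ᶠ k in atTop, dist (T i k) (s k) ≤ c / 2) ∧
      (∀ i, ∀ᶠ k in atTop, ρ ≤ dist (T i k) (s k)) ∧
      ∀ i j, i ≠ j → ∀ᶠ k in atTop, ρ ≤ dist (T i k) (T j k) := by
    induction m with
    | zero => exact ⟨Fin.elim0, 1, one_pos, by simp, by simp, by simp, by simp⟩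
    | succ m ih =>
      obtain ⟨T, ρ, hρ, hT, hTc, hTs, hTT⟩ := ih
      obtain ⟨t, ht, htr, ρ', hρ', hts⟩ := sep (ρ / 2) (by positivity)
      have htT (i) : ∀ᶠ k in atTop, min (ρ / 2) ρ' ≤ dist (T i k) (t k) := by
        filter_upwards [hTs i, htr] with k h1 h2
        have := dist_triangle (T i k) (t k) (s k)
        have := min_le_right (c / 2) (ρ / 2)
        have := min_le_left (ρ / 2) ρ'
        linarith
      refine ⟨Fin.cons t T, min (ρ / 2) ρ', by positivity, ?_, ?_, ?_, ?_⟩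
      · exact Fin.cases ht hT
      · exact Fin.cases (htr.mono fun k hk => hk.trans (min_le_left _ _)) hTc
      · refine Fin.cases (hts.mono fun k hk => (min_le_right _ _).trans hk) fun i => ?_
        filter_upwards [hTs i] with k hk
        exact ((min_le_left _ _).trans (by linarith)).trans hk
      · refine Fin.cases (Fin.cases (by simp) fun j _ => ?_) fun i => Fin.cases (fun _ => ?_)
          fun j hij => ?_
        · simpa [dist_comm] using htT j
        · simpa using htT i
        · filter_upwards [hTT i j (fun h => hij (by rw [h]))] with k hk
          exact ((min_le_left _ _).trans (by linarith)).trans hk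
  obtain ⟨T, ρ, hρ, hT, hTc, -, hTT⟩ := family (n + 1)
  refine hexp.not_separated hT (fun i j => ?_) hρ hTT
  filter_upwards [hTc i, hTc j] with k h1 h2
  linarith [dist_triangle_right (T i k) (T j k) (s k)]

/-- There is a `δ`-pseudo-orbit segment with `l` steps from `x` to `y`. -/
def ChainOfLength (f : X ≃ₜ X) (δ : ℝ) (l : ℕ) (x y : X) : Prop :=
  ∃ c : ℕ → X, c 0 = x ∧ c l = y ∧ ∀ k < l, dist (f (c k)) (c (k + 1)) < δ

lemma ChainOfLength.trans {f : X ≃ₜ X} {δ : ℝ} {l m : ℕ} {x y z : X}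
    (h₁ : ChainOfLength f δ l x y) (h₂ : ChainOfLength f δ m y z) :
    ChainOfLength f δ (l + m) x z := by
  obtain ⟨c, hc0, hcl, hc⟩ := h₁
  obtain ⟨d, hd0, hdm, hd⟩ := h₂
  refine ⟨fun k => if k ≤ l then c k else d (k - l), by simpa using hc0, ?_, fun k hk => ?_⟩
  · by_cases hm : m = 0
    · subst hm
      simp [hcl, ← hdm, hd0]
    · simp [hm, hdm]
  · rcases lt_trichotomy k l with h | h | h
    · simpa [h.le, Nat.succ_le_of_lt h] using hc k h
    · subst h
      simpa [hcl, ← hd0] using hd 0 (by omega)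
    · have h' : ¬ k ≤ l := by omega
      have h'' : ¬ k + 1 ≤ l := by omega
      simpa [h', h'', Nat.sub_add_comm h.le] using hd (k - l) (by omega)

lemma chainOfLength_one {f : X ≃ₜ X} {δ : ℝ} {x y : X} (h : dist (f x) y < δ) :
    ChainOfLength f δ 1 x y :=
  ⟨fun k => if k = 0 then x else y, by simp, by simp, fun k hk => by
    obtain rfl : k = 0 := by omega
    simpa using h⟩

lemma chainOfLength_iterate (f : X ≃ₜ X) {δ : ℝ} (hδ : 0 < δ) (l : ℕ) (x : X) :
    ChainOfLength f δ l x (f^[l] x) :=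
  ⟨fun k => f^[k] x, rfl, rfl, fun k _ => by
    simpa only [Function.iterate_succ_apply', dist_self] using hδ⟩

/-- In a transitive system, chains of bounded length join any two points. -/
lemma TopTransitive.exists_chain_bound [CompactSpace X] {f : X ≃ₜ X} (h : TopTransitive f)
    {δ : ℝ} (hδ : 0 < δ) :
    ∃ M : ℕ, ∀ x y, ∃ l, 0 < l ∧ l ≤ M ∧ ChainOfLength f δ l x y := by
  obtain ⟨F, -, hF, hcov⟩ := finite_cover_balls_of_compact (isCompact_univ (X := X))
    (show 0 < δ / 4 by positivity)
  have hk (i j : X) : ∃ k : ℕ, (f^[k] '' ball i (δ / 4) ∩ ball j (δ / 4)).Nonempty :=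
    h _ _ isOpen_ball isOpen_ball ⟨i, mem_ball_self (by positivity)⟩
      ⟨j, mem_ball_self (by positivity)⟩
  choose k hk using hk
  obtain ⟨M, hM⟩ := ((hF.prod hF).image fun q => k q.1 q.2).bddAbove
  have near (x : X) : ∃ i ∈ F, dist x i < δ / 4 := by
    simpa using hcov (mem_univ x)
  refine ⟨M + 1, fun x y => ?_⟩
  obtain ⟨i, hi, hxi⟩ := near (f x)
  obtain ⟨j, hj, hyj⟩ := near y
  have hle : k i j ≤ M := hM ⟨(i, j), ⟨hi, hj⟩, rfl⟩
  obtain ⟨-, ⟨v, hvi, rfl⟩, hvj⟩ := hk i j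
  rw [mem_ball] at hvi hvj
  have hxv : dist (f x) v < δ / 2 := by linarith [dist_triangle_right (f x) v i]
  have hvy : dist (f^[k i j] v) y < δ / 2 := by
    linarith [dist_triangle_right (f^[k i j] v) y j]
  refine ⟨k i j + 1, by omega, by omega, ?_⟩
  rcases hq : k i j with _ | q
  · rw [hq] at hvy
    refine chainOfLength_one ?_
    have := dist_triangle (f x) v y
    simp only [Function.iterate_zero, id] at hvy
    linarith
  · rw [hq, Function.iterate_succ_apply'] at hvy
    rw [show q + 1 + 1 = 1 + q + 1 by ring]
    exact ((chainOfLength_one (by linarith)).trans (chainOfLength_iterate f hδ q v)).trans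
      (chainOfLength_one (by linarith))

lemma NExpansive.exists_periodic [CompactSpace X] [Nonempty X] {f : X ≃ₜ X} {n : ℕ}
    (hexp : NExpansive f n) (htrans : TopTransitive f) (hshad : ShadowingProperty f) :
    ∃ x, Periodic f x := by
  obtain ⟨c, hc, hexp⟩ := hexp.exists_not_injective
  obtain ⟨δ, hδ, hshad⟩ := hshad (c / 2) (by positivity)
  obtain ⟨M, hM⟩ := htrans.exists_chain_bound hδ
  let x₀ : X := Classical.arbitrary X
  obtain ⟨l, hl, -, w, hw0, hwl, hw⟩ := hM x₀ x₀
  have hl' : (0 : ℤ) < l := by exact_mod_cast hl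
  obtain ⟨z, hz⟩ := hshad (fun k => w (k % l).toNat) fun k => by
    have h0 := Int.emod_nonneg k hl'.ne'
    have h1 := Int.emod_lt_of_pos k hl'
    have h2 := hw (k % l).toNat (by omega)
    rcases eq_or_ne (k % l + 1) l with h3 | h3
    · have h4 : (k + 1) % l = 0 := by rw [← Int.emod_add_emod, h3, Int.emod_self]
      rw [show (k % l).toNat + 1 = l by omega, hwl, ← hw0] at h2
      simpa [h4] using h2
    · have h4 : (k + 1) % l = k % l + 1 := by
        rw [← Int.emod_add_emod]
        exact Int.emod_eq_of_lt (by omega) (by omega)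
      simpa [h4, show (k % l + 1).toNat = (k % l).toNat + 1 by omega] using h2
  have key := hexp (fun i => hIter f (i * l : ℤ) z) fun i j k => by
    have h1 := hz (k + i * l)
    have h2 := hz (k + j * l)
    simp only [Int.add_mul_emod_self_right] at h1 h2
    rw [← hIter_add, ← hIter_add]
    linarith [dist_triangle_right (hIter f (k + i * l) z) (hIter f (k + j * l) z)
      (w (k % l).toNat)]
  have period {i j : ℕ} (hij : i < j) (h : hIter f (i * l : ℤ) z = hIter f (j * l : ℤ) z) :
      Periodic f z := by
    obtain ⟨d, rfl⟩ := Nat.exists_eq_add_of_lt hij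
    refine ⟨(d + 1) * l, Nat.mul_pos d.succ_pos hl, ?_⟩
    rw [← hIter_natCast]
    refine hIter_injective f (i * l) ?_
    rw [← hIter_add, h]
    congr 1
    push_cast
    ring
  simp only [Function.Injective, not_forall] at key
  obtain ⟨i, j, hij, hne⟩ := key
  rcases lt_or_gt_of_ne (fun h => hne (Fin.ext h) : (i : ℕ) ≠ j) with hlt | hlt
  · exact ⟨z, period hlt hij⟩
  · exact ⟨z, period hlt hij.symm⟩

lemma Periodic.iterate_mul {f : X ≃ₜ X} {P : ℕ} {x : X} (h : f^[P] x = x) (j : ℕ) :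
    f^[j * P] x = x := by
  rw [mul_comm, Function.iterate_mul]
  exact Function.iterate_fixed h j

/-- Splicing the past of a sequence with its `K`-shifted future along a chain. -/
lemma ChainOfLength.exists_splice {f : X ≃ₜ X} {δ : ℝ} {x : ℤ → X} {a b : ℤ} {L : ℕ}
    (hL : 0 < L) (hc : ChainOfLength f δ L (x (-a)) (x b))
    (hpast : ∀ k < -a, dist (f (x k)) (x (k + 1)) < δ)
    (hfut : ∀ k ≥ b, dist (f (x k)) (x (k + 1)) < δ) :
    ∃ w, IsPseudoOrbit f δ w ∧ (∀ k < -a, w k = x k) ∧ ∀ k ≥ b, w (L - a - b + k) = x k := by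
  obtain ⟨c, hc0, hcL, hc⟩ := hc
  let w (k : ℤ) : X :=
    if k < -a then x k else if k < L - a then c (k + a).toNat else x (k - (L - a - b))
  refine ⟨w, fun k => ?_, fun k hk => by simp only [w, if_pos hk], fun k hk => ?_⟩
  · rcases lt_trichotomy (k + 1) (-a) with h1 | h1 | h1
    · simp only [w, h1, show k < -a by omega, if_true]
      exact hpast k (by omega)
    · have := hpast k (by omega)
      simp only [w, show k < -a by omega, show ¬ k + 1 < -a by omega, if_true, if_false,
        show k + 1 < L - a by omega, show (k + 1 + a).toNat = 0 by omega, hc0]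
      rwa [h1] at this
    · have h2 : ¬ k < -a := by omega
      have h3 : ¬ k + 1 < -a := by omega
      simp only [w, h2, h3, if_false]
      rcases lt_trichotomy (k + 1) (L - a) with h4 | h4 | h4
      · simp only [h4, show k < L - a by omega, if_true,
          show (k + 1 + a).toNat = (k + a).toNat + 1 by omega]
        exact hc _ (by omega)
      · have := hc (k + a).toNat (by omega)
        rw [show (k + a).toNat + 1 = L by omega, hcL] at this
        simpa only [show k < L - a by omega, show ¬ k + 1 < L - a by omega, if_true, if_false,
          show k + 1 - (L - a - b) = b by omega] using this
      · simp only [show ¬ k < L - a by omega, show ¬ k + 1 < L - a by omega, if_false]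
        rw [show k + 1 - (L - a - b) = k - (L - a - b) + 1 by ring]
        exact hfut _ (by omega)
  · simp only [w, show ¬ (L - a - b + k < -a) by omega, show ¬ (L - a - b + k < L - a) by omega,
      if_false]
    congr 1
    omega

theorem stmt4 {X : Type*} [MetricSpace X] [CompactSpace X] (f : X ≃ₜ X) (n : ℕ)
    (hn : 0 < n) (hexp : NExpansive f n) (htrans : TopTransitive f)
    (hshad : ShadowingProperty f) :
    ∃ N : ℕ, ∀ x : ℤ → X, IsTwoSidedLimitPseudoOrbit f x →
      ∃ K : ℤ, |K| ≤ (N : ℤ) ∧ ∃ z : X, TwoSidedLimitShadowsWithGap f K z x := by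
  rcases isEmpty_or_nonempty X with hX | hX
  · exact ⟨0, fun x => hX.elim (x 0)⟩
  obtain ⟨p, P, hP, hp⟩ := hexp.exists_periodic htrans hshad
  refine ⟨P, fun x hx => ?_⟩
  obtain ⟨r, hr, hfwd⟩ := hexp.exists_asymptotic_radius hshad hx.forward
  obtain ⟨r', hr', hbwd⟩ := hexp.symm.exists_asymptotic_radius hshad.symm hx.backward
  obtain ⟨δ, hδ, hshad⟩ := hshad (min r r') (by positivity)
  obtain ⟨M, hM⟩ := htrans.exists_chain_bound hδ
  obtain ⟨A, hA⟩ := eventually_atBot.1 (hx.tendsto_atBot.eventually (gt_mem_nhds hδ))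
  obtain ⟨B, hB⟩ := eventually_atTop.1 (hx.forward.eventually (gt_mem_nhds hδ))
  obtain ⟨a, hAa, hMa⟩ : ∃ a, -A ≤ a ∧ (M : ℤ) ≤ a :=
    ⟨max (-A) M, le_max_left _ _, le_max_right _ _⟩
  obtain ⟨b, hBb, hMb⟩ : ∃ b, B ≤ b ∧ (M : ℤ) ≤ b :=
    ⟨max B M, le_max_left _ _, le_max_right _ _⟩
  obtain ⟨l₁, hl₁, hl₁M, hc₁⟩ := hM (x (-a)) p
  obtain ⟨l₂, hl₂, hl₂M, hc₂⟩ := hM p (x b)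
  obtain ⟨D, hD⟩ : ∃ D : ℕ, (D : ℤ) = a + b - l₁ - l₂ := ⟨(a + b - l₁ - l₂).toNat, by omega⟩
  have hloop := chainOfLength_iterate f hδ ((D / P + 1) * P) p
  rw [Periodic.iterate_mul hp] at hloop
  obtain ⟨w, hw, hwpast, hwfut⟩ := ((hc₁.trans hloop).trans hc₂).exists_splice (by omega)
    (fun k hk => hA k (by omega)) (fun k hk => hB k (by omega))
  obtain ⟨z, hz⟩ := hshad w hw
  have hK : ((l₁ + (D / P + 1) * P + l₂ : ℕ) : ℤ) - a - b = P - (D % P : ℕ) := by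
    have h := Nat.div_add_mod D P
    have h' : (D / P + 1) * P = P * (D / P) + P := by ring
    omega
  rw [hK] at hwfut
  have hmod := Nat.mod_lt D hP
  refine ⟨P - (D % P : ℕ), by rw [abs_le]; omega, z, ?_, ?_⟩
  · have h := hbwd (fun k => hIter f.symm (0 + k) z) (isForwardLimitPseudoOrbit_hIter _ 0 z) (by
      filter_upwards [eventually_gt_atTop a] with k hk
      rw [zero_add, hIter_symm, ← hwpast (-k) (by omega)]
      exact (hz _).le.trans (min_le_right _ _))
    simpa [Function.comp_def, hIter_symm] using h.comp tendsto_neg_atBot_atTop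
  · refine hfwd _ (isForwardLimitPseudoOrbit_hIter _ _ z) ?_
    filter_upwards [eventually_ge_atTop b] with k hk
    rw [← hwfut k hk]
    exact (hz _).le.trans (min_le_left _ _)
end

section
/- Let f be a homeomorphism of a compact metric space (X,d) and let n be a positive integer. If f is positively n-expansive, has the shadowing property, and admits only finitely many chain recurrent classes, then X is a finite set. -/
open Metric Filter Set

variable {X : Type*} [MetricSpace X]

/-- `c 0, …, c l` is a finite `ε`-pseudo-orbit of `f`. -/
def IsFiniteChain (f : X ≃ₜ X) (ε : ℝ) (l : ℕ) (c : ℕ → X) : Prop :=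
  ∀ k < l, dist (f (c k)) (c (k + 1)) < ε

/-- The sequence following `c` up to time `l` and `c'` afterwards. -/
def joinAt {Y : Type*} (l : ℕ) (c c' : ℕ → Y) (i : ℕ) : Y :=
  if i ≤ l then c i else c' (i - l)

lemma joinAt_of_le {Y : Type*} {l i : ℕ} (h : i ≤ l) (c c' : ℕ → Y) : joinAt l c c' i = c i :=
  if_pos h

lemma joinAt_add {Y : Type*} {l : ℕ} {c c' : ℕ → Y} (h : c l = c' 0) (i : ℕ) :
    joinAt l c c' (l + i) = c' i := by
  unfold joinAt
  rcases Nat.eq_zero_or_pos i with rfl | hi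
  · simpa using h
  · rw [if_neg (by omega), Nat.add_sub_cancel_left]

lemma IsFiniteChain.join {f : X ≃ₜ X} {ε : ℝ} {l l' : ℕ} {c c' : ℕ → X}
    (hc : IsFiniteChain f ε l c) (hc' : IsFiniteChain f ε l' c') (h : c l = c' 0) :
    IsFiniteChain f ε (l + l') (joinAt l c c') := by
  intro k hk
  rcases lt_or_ge k l with hkl | hkl
  · rw [joinAt_of_le hkl.le, joinAt_of_le hkl]
    exact hc k hkl
  · obtain ⟨i, rfl⟩ := Nat.exists_eq_add_of_le hkl
    rw [add_assoc, joinAt_add h, joinAt_add h]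
    exact hc' i (by omega)

lemma ChainFrom.trans {f : X ≃ₜ X} {ε : ℝ} {x y z : X}
    (h : ChainFrom f ε x y) (h' : ChainFrom f ε y z) : ChainFrom f ε x z := by
  obtain ⟨l, c, hl, h0, h1, hc⟩ := h
  obtain ⟨l', c', hl', h0', h1', hc'⟩ := h'
  have h : c l = c' 0 := by rw [h1, h0']
  exact ⟨l + l', joinAt l c c', by omega, by rw [joinAt_of_le (Nat.zero_le _), h0],
    by rw [joinAt_add h, h1'], IsFiniteChain.join hc hc' h⟩

lemma chainFrom_of_dist_map_lt {f : X ≃ₜ X} {ε : ℝ} {x y : X} (h : dist (f x) y < ε) :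
    ChainFrom f ε x y := by
  refine ⟨1, fun i => if i = 0 then x else y, one_pos, by simp, by simp, fun k hk => ?_⟩
  obtain rfl : k = 0 := by omega
  simpa using h

lemma chainFrom_of_dist_iterate_lt {f : X ≃ₜ X} {ε : ℝ} {x y : X} {k : ℕ}
    (h : dist (f^[k + 1] x) y < ε) : ChainFrom f ε x y := by
  have hε : 0 < ε := dist_nonneg.trans_lt h
  induction k generalizing x with
  | zero => exact chainFrom_of_dist_map_lt h
  | succ k ih =>
    exact (chainFrom_of_dist_map_lt (by simpa using hε)).trans (ih (x := f x) h)

lemma ChainFrom.mono {f : X ≃ₜ X} {ε ε' : ℝ} {x y : X} (h : ChainFrom f ε x y)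
    (hε : ε ≤ ε') : ChainFrom f ε' x y := by
  obtain ⟨l, c, hl, h0, h1, hc⟩ := h
  exact ⟨l, c, hl, h0, h1, fun k hk => (hc k hk).trans_le hε⟩

/-- Every point has chains of every precision to some chain recurrent point. -/
lemma exists_chainRecurrent_forall_chainFrom [CompactSpace X] (f : X ≃ₜ X) (x : X) :
    ∃ p, ChainRecurrent f p ∧ ∀ ε > 0, ChainFrom f ε x p := by
  obtain ⟨p, hp⟩ := exists_clusterPt_of_compactSpace (map (fun k : ℕ => f^[k] x) atTop)
  have hfreq : ∀ U ∈ nhds p, ∀ N : ℕ, ∃ k ≥ N, f^[k] x ∈ U := fun U hU N =>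
    (mapClusterPt_iff_frequently.1 hp U hU).forall_exists_of_atTop N
  refine ⟨p, fun ε hε => ?_, fun ε hε => ?_⟩
  · obtain ⟨k, -, hk⟩ := hfreq _ (f.continuous.continuousAt.preimage_mem_nhds
      (ball_mem_nhds (f p) hε)) 0
    obtain ⟨m, hm, hmp⟩ := hfreq _ (ball_mem_nhds p hε) (k + 2)
    obtain ⟨i, rfl⟩ := Nat.exists_eq_add_of_le hm
    refine (chainFrom_of_dist_map_lt (y := f^[k + 1] x) ?_).trans
      (chainFrom_of_dist_iterate_lt (k := i) ?_)
    · rw [dist_comm, Function.iterate_succ_apply']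
      exact hk
    · rw [← Function.iterate_add_apply]
      rw [show i + 1 + (k + 1) = k + 2 + i by ring]
      exact hmp
  · obtain ⟨k, hk, hkp⟩ := hfreq _ (ball_mem_nhds p hε) 1
    obtain ⟨i, rfl⟩ := Nat.exists_eq_add_of_le hk
    refine chainFrom_of_dist_iterate_lt (k := i) ?_
    rw [add_comm i 1]
    exact hkp

/-- A chain recurrent point is terminal if it can be reached back from every chain recurrent
point that it reaches. -/
def IsTerminal (f : X ≃ₜ X) (x : X) : Prop :=
  ChainRecurrent f x ∧ ∀ y, ChainRecurrent f y → (∀ ε > 0, ChainFrom f ε x y) →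
    ∀ ε > 0, ChainFrom f ε y x

lemma exists_isTerminal_forall_chainFrom [CompactSpace X] (f : X ≃ₜ X)
    (hfin : {C : Set X | ∃ x : X, ChainRecurrent f x ∧ C = chainClass f x}.Finite) (x : X) :
    ∃ p, IsTerminal f p ∧ ∀ ε > 0, ChainFrom f ε x p := by
  let R : X → Set (Set X) := fun q =>
    {C | ∃ y, ChainRecurrent f y ∧ C = chainClass f y ∧ ∀ ε > 0, ChainFrom f ε q y}
  have hR : ∀ q, (R q).Finite := fun q => hfin.subset fun C ⟨y, hy, hC, _⟩ => ⟨y, hy, hC⟩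
  let S : Set X := {q | ChainRecurrent f q ∧ ∀ ε > 0, ChainFrom f ε x q}
  have hS : S.Nonempty := exists_chainRecurrent_forall_chainFrom f x
  obtain ⟨q, ⟨hq, hxq⟩, hmin⟩ :=
    (measure fun q => (R q).ncard).wf.has_min S hS
  refine ⟨q, ⟨hq, fun y hy hqy => ?_⟩, hxq⟩
  have hsub : R y ⊆ R q := fun C ⟨w, hw, hC, hyw⟩ =>
    ⟨w, hw, hC, fun ε hε => (hqy ε hε).trans (hyw ε hε)⟩
  have hcard : (R q).ncard ≤ (R y).ncard :=
    not_lt.1 (hmin y ⟨hy, fun ε hε => (hxq ε hε).trans (hqy ε hε)⟩)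
  have hmem : chainClass f q ∈ R y := by
    rw [Set.eq_of_subset_of_ncard_le hsub hcard (hR q)]
    exact ⟨q, hq, rfl, hq⟩
  obtain ⟨w, hw, hqw, hyw⟩ := hmem
  have hwq : w ∈ chainClass f q := by
    rw [hqw]
    exact fun ε hε => ⟨hw ε hε, hw ε hε⟩
  exact fun ε hε => (hyw ε hε).trans (hwq ε hε).2

/-- With finitely many chain recurrent classes, reachability of chain recurrent points from `x`
is detected at a single precision. -/
lemma exists_pos_forall_chainFrom_of_chainFrom (f : X ≃ₜ X)
    (hfin : {C : Set X | ∃ x : X, ChainRecurrent f x ∧ C = chainClass f x}.Finite) (x : X) :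
    ∃ δ > 0, ∀ y, ChainRecurrent f y → ChainFrom f δ x y → ∀ ε > 0, ChainFrom f ε x y := by
  have key : ∀ C ∈ {C : Set X | ∃ x : X, ChainRecurrent f x ∧ C = chainClass f x},
      ∀ᶠ δ : ℝ in nhdsWithin 0 (Ioi 0), ∀ y, ChainRecurrent f y → chainClass f y = C →
        ChainFrom f δ x y → ∀ ε > 0, ChainFrom f ε x y := by
    rintro C ⟨w, hw, rfl⟩
    have hclass : ∀ y, ChainRecurrent f y → chainClass f y = chainClass f w →
        ∀ ε > 0, ChainFrom f ε w y ∧ ChainFrom f ε y w := by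
      intro y hy hyw
      have : y ∈ chainClass f w := by
        rw [← hyw]
        exact fun ε hε => ⟨hy ε hε, hy ε hε⟩
      exact this
    by_cases h : ∀ ε > 0, ChainFrom f ε x w
    · exact Eventually.of_forall fun δ y hy hyw _ ε hε =>
        (h ε hε).trans (hclass y hy hyw ε hε).1
    · push Not at h
      obtain ⟨ε₀, hε₀, hno⟩ := h
      filter_upwards [Ioo_mem_nhdsGT hε₀] with δ hδ y hy hyw hxy
      exact absurd ((hxy.trans (hclass y hy hyw δ hδ.1).2).mono hδ.2.le) hno
  obtain ⟨δ, hδ, hδ0⟩ :=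
    (((eventually_all_finite hfin).2 key).and self_mem_nhdsWithin).exists
  exact ⟨δ, hδ0, fun y hy => hδ _ ⟨y, hy, rfl⟩ y hy rfl⟩

lemma exists_near_iterate_near {f : X ≃ₜ X} (hshad : ShadowingProperty f) {x y : X}
    (h : ∀ ε > 0, ChainFrom f ε x y) {ε : ℝ} (hε : 0 < ε) :
    ∃ z, ∃ l > 0, dist z x < ε ∧ dist (f^[l] z) y < ε := by
  obtain ⟨δ, hδ, hsh⟩ := hshad ε hε
  obtain ⟨l, c, hl, h0, h1, hc⟩ := h δ hδ
  let P : ℤ → X := fun k => if k < 0 then hIter f k x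
    else if k ≤ l then c k.toNat else hIter f (k - l) y
  have hP : IsPseudoOrbit f δ P := by
    intro k
    dsimp only [P]
    rcases lt_trichotomy k (-1) with hk | rfl | hk
    · rw [if_pos (by omega), if_pos (by omega), hIter_add_one, dist_self]
      exact hδ
    · rw [if_pos (by omega), if_neg (by omega), if_pos (by omega), ← hIter_add_one]
      simpa [h0, hIter] using hδ
    · lift k to ℕ using by omega
      rcases lt_trichotomy k l with hkl | rfl | hkl
      · rw [if_neg (by omega), if_pos (by omega), if_neg (by omega), if_pos (by omega)]
        exact hc k hkl
      · rw [if_neg (by omega), if_pos le_rfl, if_neg (by omega), if_neg (by omega),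
          add_sub_cancel_left]
        simpa [h1, hIter] using hδ
      · rw [if_neg (by omega), if_neg (by omega), if_neg (by omega), if_neg (by omega),
          add_sub_right_comm, hIter_add_one, dist_self]
        exact hδ
  obtain ⟨z, hz⟩ := hsh P hP
  refine ⟨z, l, hl, ?_, ?_⟩
  · simpa [P, h0, hIter] using hz 0
  · simpa [P, h1, hIter_natCast, (Int.natCast_nonneg l).not_gt] using hz l

/-- Two loops of the same length at the same point which are far apart at some time produce
infinitely many points with nearby futures. -/
lemma exists_infinite_localStable {f : X ≃ₜ X} {c δ : ℝ}
    (hsh : ∀ x : ℤ → X, IsPseudoOrbit f δ x → ∃ z : X, Shadows f (c / 2) z x)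
    {L k : ℕ} {a b : ℕ → X} (ha : IsFiniteChain f δ L a) (hb : IsFiniteChain f δ L b)
    (haL : a L = a 0) (hbL : b L = b 0) (hab : a 0 = b 0) (hk : k < L)
    (hd : c < dist (a k) (b k)) : ∃ x, (localStable f c x).Infinite := by
  have hL : (0 : ℤ) < L := by omega
  let P : ℕ → ℤ → X := fun i j => if j / L = -1 - (i : ℤ) then a (j % L).toNat else b (j % L).toNat
  have hP : ∀ i, IsPseudoOrbit f δ (P i) := by
    intro i j
    have hr0 := Int.emod_nonneg j hL.ne'
    have hr1 := Int.emod_lt_of_pos j hL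
    have hj := Int.emod_add_mul_ediv j L
    set q := j / (L : ℤ) with hq
    obtain ⟨r, hr⟩ := Int.eq_ofNat_of_zero_le hr0
    have hrL : r < L := by omega
    rcases lt_or_ge (r + 1) L with hlt | hge
    · have h1 : (j + 1) / (L : ℤ) = q := by
        rw [← hj, hr, show (r : ℤ) + L * q + 1 = ((r + 1 : ℕ) : ℤ) + L * q by push_cast; ring,
          Int.add_mul_ediv_left _ _ hL.ne', Int.ediv_eq_zero_of_lt (by omega) (by omega), zero_add]
      have h2 : (j + 1) % (L : ℤ) = ((r + 1 : ℕ) : ℤ) := by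
        rw [← hj, hr, show (r : ℤ) + L * q + 1 = ((r + 1 : ℕ) : ℤ) + L * q by push_cast; ring,
          Int.add_mul_emod_self_left, Int.emod_eq_of_lt (by omega) (by omega)]
      simp only [P, h1, h2, ← hq, hr, Int.toNat_natCast]
      split_ifs
      · exact ha r hrL
      · exact hb r hrL
    · have hrL' : r + 1 = L := by omega
      have h2 : (j + 1) % (L : ℤ) = 0 := by
        rw [← hj, hr, show (r : ℤ) + L * q + 1 = 0 + L * (q + 1) by
          rw [← hrL']; push_cast; ring, Int.add_mul_emod_self_left, Int.zero_emod]
      have hnext : P i (j + 1) = a 0 := by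
        simp only [P, h2, Int.toNat_zero, ← hab, ite_self]
      rw [hnext]
      simp only [P, ← hq, hr, Int.toNat_natCast]
      split_ifs
      · rw [← haL, ← hrL']
        exact ha r hrL
      · rw [hab, ← hbL, ← hrL']
        exact hb r hrL
  choose z hz using fun i => hsh (P i) (hP i)
  have hinj : Function.Injective z := by
    intro i i' hii
    by_contra hne
    have hdiv : ((k : ℤ) + L * (-1 - (i : ℤ))) / (L : ℤ) = -1 - i := by
      rw [Int.add_mul_ediv_left _ _ hL.ne', Int.ediv_eq_zero_of_lt (by omega) (by omega), zero_add]
    have hmod : ((k : ℤ) + L * (-1 - (i : ℤ))) % (L : ℤ) = k := by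
      rw [Int.add_mul_emod_self_left, Int.emod_eq_of_lt (by omega) (by omega)]
    have h1 := hz i ((k : ℤ) + L * (-1 - (i : ℤ)))
    have h2 := hz i' ((k : ℤ) + L * (-1 - (i : ℤ)))
    simp only [P, hdiv, hmod, Int.toNat_natCast, if_true] at h1 h2
    rw [if_neg (by omega)] at h2
    rw [← hii] at h2
    rw [dist_comm] at h1
    linarith [dist_triangle (a k) (hIter f ((k : ℤ) + L * (-1 - (i : ℤ))) (z i)) (b k)]
  refine ⟨z 0, (Set.infinite_range_of_injective hinj).mono ?_⟩
  rintro _ ⟨i, rfl⟩ j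
  have hfut : ∀ i, P i j = b (j % L) := by
    intro i
    have : (0 : ℤ) ≤ (j : ℤ) / L := Int.ediv_nonneg (by omega) hL.le
    simp only [P]
    rw [if_neg (by omega), ← Int.natCast_mod, Int.toNat_natCast]
  have h1 := hz i j
  have h2 := hz 0 j
  rw [hfut, hIter_natCast] at h1 h2
  linarith [dist_triangle_right (f^[j] (z i)) (f^[j] (z 0)) (b (j % L))]

lemma IsTerminal.isOpen_singleton [CompactSpace X] {f : X ≃ₜ X} {c : ℝ} (hc : 0 < c)
    (hexp : ∀ x, (localStable f c x).Finite) (hshad : ShadowingProperty f)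
    (hfin : {C : Set X | ∃ x : X, ChainRecurrent f x ∧ C = chainClass f x}.Finite)
    {x : X} (hx : IsTerminal f x) : IsOpen ({x} : Set X) := by
  by_contra hopen
  obtain ⟨δ₁, hδ₁, hsh⟩ := hshad (c / 2) (by positivity)
  obtain ⟨δ₂, hδ₂, hreach⟩ := exists_pos_forall_chainFrom_of_chainFrom f hfin x
  obtain ⟨δ, hδ, hδ1, hδ2⟩ : ∃ δ > 0, δ ≤ δ₁ ∧ δ ≤ δ₂ :=
    ⟨min δ₁ δ₂, lt_min hδ₁ hδ₂, min_le_left _ _, min_le_right _ _⟩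
  have hback : ∀ w, ChainFrom f δ x w → ChainFrom f δ w x := by
    intro w hw
    obtain ⟨p, hp, hwp⟩ := exists_chainRecurrent_forall_chainFrom f w
    exact (hwp δ hδ).trans
      (hx.2 p hp (hreach p hp ((hw.trans (hwp δ hδ)).mono hδ2)) δ hδ)
  obtain ⟨y, hyx, hyc, hfy, hyS⟩ : ∃ y, y ≠ x ∧ dist y x < c ∧ dist (f y) (f x) < δ ∧
      y ∉ localStable f c x \ {x} := by
    have hne : (nhdsWithin x {x}ᶜ).NeBot := by
      rw [neBot_iff]
      exact fun h => hopen ((isOpen_singleton_iff_punctured_nhds x).2 h)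
    have h1 : ∀ᶠ y in nhds x, dist y x < c := ball_mem_nhds x hc
    have h2 : ∀ᶠ y in nhds x, dist (f y) (f x) < δ :=
      f.continuous.continuousAt.preimage_mem_nhds (ball_mem_nhds (f x) hδ)
    have h3 : ∀ᶠ y in nhds x, y ∉ localStable f c x \ {x} :=
      ((hexp x).subset sdiff_subset).isClosed.isOpen_compl.mem_nhds (by simp)
    have h4 : ∀ᶠ y in nhdsWithin x {x}ᶜ, y ≠ x := self_mem_nhdsWithin
    exact (h4.and (((h1.and (h2.and h3))).filter_mono nhdsWithin_le_nhds)).exists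
  have hyS' : y ∉ localStable f c x := fun h => hyS ⟨h, hyx⟩
  simp only [localStable, mem_ofPred_eq, not_forall, not_le] at hyS'
  obtain ⟨_ | k, hk⟩ := hyS'
  · exact absurd hk hyc.not_gt
  obtain ⟨l, r, hl, hr0, hr1, hr⟩ := hback (f^[k + 1] x)
    (chainFrom_of_dist_iterate_lt (k := k) (by simpa using hδ))
  obtain ⟨l', r', hl', hr0', hr1', hr'⟩ := hback (f^[k + 1] y) (by
    have h1 : ChainFrom f δ x (f y) := chainFrom_of_dist_map_lt (by rwa [dist_comm])
    rcases k with _ | k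
    · exact h1
    · exact h1.trans (chainFrom_of_dist_iterate_lt (k := k) (by simpa using hδ)))
  let p : ℕ → X := fun i => f^[i] x
  let p' : ℕ → X := fun i => if i = 0 then x else f^[i] y
  have hp : IsFiniteChain f δ (k + 1) p := by
    intro i _
    simp only [p, Function.iterate_succ_apply', dist_self]
    exact hδ
  have hp' : IsFiniteChain f δ (k + 1) p' := by
    intro i _
    rcases i with _ | i
    · simpa [p', dist_comm] using hfy
    · simp only [p', Nat.add_eq_zero_iff, one_ne_zero, and_false, if_false]
      rw [Function.iterate_succ_apply' f (i + 1), dist_self]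
      exact hδ
  have hpr : p (k + 1) = r 0 := hr0.symm
  have hpr' : p' (k + 1) = r' 0 := by rw [hr0']; simp [p']
  let a := joinAt (k + 1) p r
  let b := joinAt (k + 1) p' r'
  have ha : IsFiniteChain f δ (k + 1 + l) a := hp.join hr hpr
  have hb : IsFiniteChain f δ (k + 1 + l') b := hp'.join hr' hpr'
  have ha0 : a 0 = x := joinAt_of_le (Nat.zero_le _) _ _
  have hb0 : b 0 = x := joinAt_of_le (Nat.zero_le _) _ _
  have ha1 : a (k + 1 + l) = x := (joinAt_add hpr l).trans hr1
  have hb1 : b (k + 1 + l') = x := (joinAt_add hpr' l').trans hr1'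
  have hab : a (k + 1 + l) = b 0 := by rw [ha1, hb0]
  have hba : b (k + 1 + l') = a 0 := by rw [hb1, ha0]
  have hab' := ha.join hb hab
  have hba' := hb.join ha hba
  rw [add_comm (k + 1 + l') (k + 1 + l)] at hba'
  have hd : c < dist (joinAt (k + 1 + l') b a (k + 1)) (joinAt (k + 1 + l) a b (k + 1)) := by
    rw [joinAt_of_le (by omega), joinAt_of_le (by omega)]
    simpa [a, b, p, p', joinAt_of_le] using hk
  obtain ⟨w, hw⟩ := exists_infinite_localStable
    (fun z hz => hsh z fun j => (hz j).trans_le hδ1) hba' hab'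
    (by rw [add_comm (k + 1 + l) (k + 1 + l'), joinAt_add hba, ha1, joinAt_of_le (Nat.zero_le _), hb0])
    (by rw [joinAt_add hab, hb1, joinAt_of_le (Nat.zero_le _), ha0])
    (by rw [joinAt_of_le (Nat.zero_le _), joinAt_of_le (Nat.zero_le _), ha0, hb0])
    (by omega) hd
  exact hw (hexp w)

/-- Under shadowing, an open chain recurrent point `p` is periodic, and a point with chains of
every precision to `p` lies on its orbit. -/
lemma isOpen_singleton_of_forall_chainFrom {f : X ≃ₜ X} (hshad : ShadowingProperty f) {x p : X}
    (hp : ChainRecurrent f p) (hopen : IsOpen ({p} : Set X))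
    (h : ∀ ε > 0, ChainFrom f ε x p) : IsOpen ({x} : Set X) := by
  obtain ⟨ε₀, hε₀, hball⟩ := Metric.isOpen_iff.1 hopen p rfl
  obtain ⟨z, l, hl, hz, hlz⟩ := exists_near_iterate_near hshad hp hε₀
  obtain rfl : z = p := hball hz
  have hper : Function.IsPeriodicPt f l z := hball hlz
  have hfinite : ((fun i => f^[i] z) '' (Set.Iio l)).Finite := (Set.finite_Iio l).image _
  have hmem : x ∈ closure ((fun i => f^[i] z) '' (Set.Iio l)) := by
    rw [Metric.mem_closure_iff]
    intro ε hε
    obtain ⟨w, m, hm, hw, hmw⟩ := exists_near_iterate_near hshad h (lt_min hε hε₀)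
    have hmw' : f^[m] w = z := hball (hmw.trans_le (min_le_right _ _))
    refine ⟨w, ?_, by rw [dist_comm]; exact hw.trans_le (min_le_left _ _)⟩
    have hwz : w = f^[m * l - m] z := by
      apply f.injective.iterate m
      rw [hmw', ← Function.iterate_add_apply,
        Nat.add_sub_cancel' (Nat.le_mul_of_pos_right m hl)]
      exact (hper.const_mul m).symm
    exact ⟨(m * l - m) % l, Nat.mod_lt _ hl, by rw [hwz]; exact hper.iterate_mod_apply _⟩
  rw [hfinite.isClosed.closure_eq] at hmem
  obtain ⟨i, -, rfl⟩ := hmem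
  have hpre := hopen.preimage (f.symm.continuous.iterate i)
  convert hpre using 1
  have hinv : Function.LeftInverse f.symm^[i] f^[i] :=
    Function.LeftInverse.iterate f.symm_apply_apply i
  have hinv' : Function.LeftInverse f^[i] f.symm^[i] :=
    Function.LeftInverse.iterate f.apply_symm_apply i
  ext w
  simp only [mem_singleton_iff, mem_preimage]
  exact ⟨fun h => by rw [h]; exact hinv z, fun h => by rw [← h]; exact (hinv' w).symm⟩

theorem stmt7 {X : Type*} [MetricSpace X] [CompactSpace X] (f : X ≃ₜ X) (n : ℕ)
    (hn : 0 < n) (hexp : PosNExpansive f n) (hshad : ShadowingProperty f)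
    (hfin : {C : Set X | ∃ x : X, ChainRecurrent f x ∧ C = chainClass f x}.Finite) :
    Finite X := by
  obtain ⟨c, hc, hexp⟩ := hexp
  have hstable : ∀ x, (localStable f c x).Finite := by
    intro x
    by_contra hinf
    obtain ⟨S, hS, hcard⟩ := Set.Infinite.exists_subset_card_eq hinf (n + 1)
    have := hexp x S hS
    omega
  have : DiscreteTopology X := discreteTopology_iff_isOpen_singleton.2 fun x => by
    obtain ⟨p, hp, hxp⟩ := exists_isTerminal_forall_chainFrom f hfin x
    exact isOpen_singleton_of_forall_chainFrom hshad hp.1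
      (hp.isOpen_singleton hc hstable hshad hfin) hxp
  exact finite_of_compact_of_discrete
end
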